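/- Fix r, u ∈ ℕ. Then Σ_{n ≤ x} τ_r(nu) = (f₁(u) x (log x)^{r−1}/(r−1)!) (1 + O(1/log x)) as x → ∞. -/

import Mathlib

open Filter Finset

/-- `τ_r(n)`, the `r`-th divisor function: the number of ordered `r`-tuples of positive
integers whose product is `n`; equivalently the coefficient of `n^{-s}` in `ζ(s)^r`. -/
noncomputable def tauR (r n : ℕ) : ℕ := (ArithmeticFunction.zeta ^ r : ArithmeticFunction ℕ) n

/-- The multiplicative function `f₁` determined on prime powers by
`f₁(p^e) = (Σ_{j≥0} τ_r(p^{e+j})/p^j) / (Σ_{j≥0} τ_r(p^j)/p^j)`. -/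
noncomputable def fOne (r n : ℕ) : ℝ :=
  ∏ p ∈ n.primeFactors,
    (∑' j : ℕ, (tauR r (p ^ (n.factorization p + j)) : ℝ) / p ^ j) /
      (∑' j : ℕ, (tauR r (p ^ j) : ℝ) / p ^ j)

lemma tauR_succ_pow_prime {p : ℕ} (hp : p.Prime) (r k : ℕ) :
    tauR (r + 1) (p ^ k) = ∑ i ∈ antidiagonal k, tauR r (p ^ i.1) := by
  rw [tauR, pow_succ, ArithmeticFunction.mul_zeta_apply, Nat.sum_divisors_prime_pow hp,
    Nat.sum_antidiagonal_eq_sum_range_succ_mk]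
  rfl

lemma tauR_mul_of_coprime (r : ℕ) {m n : ℕ} (h : m.Coprime n) :
    tauR r (m * n) = tauR r m * tauR r n :=
  (ArithmeticFunction.isMultiplicative_zeta.pow).map_mul_of_coprime h

@[simp] lemma tauR_one (r : ℕ) : tauR r 1 = 1 :=
  (ArithmeticFunction.isMultiplicative_zeta.pow).map_one

/-- The generating series `Σ_k τ_r(p^k) X^k`, shifted by `a`. -/
noncomputable def tauSeries (r p a : ℕ) : PowerSeries ℝ :=
  PowerSeries.mk fun k => (tauR r (p ^ (a + k)) : ℝ)

lemma tauSeries_zero_mul {p : ℕ} (hp : p.Prime) (r : ℕ) :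
    tauSeries r p 0 * (1 - PowerSeries.X) ^ r = 1 := by
  induction r with
  | zero =>
    ext k
    rcases Nat.eq_zero_or_pos k with rfl | hk
    · simp [tauSeries]
    · simp [tauSeries, tauR, PowerSeries.coeff_one, hk.ne', ArithmeticFunction.one_apply,
        hp.ne_one]
  | succ r ih =>
    have h : tauSeries (r + 1) p 0 = tauSeries r p 0 * PowerSeries.mk 1 := by
      ext k
      simp [tauSeries, PowerSeries.coeff_mul, tauR_succ_pow_prime hp]
    rw [h, pow_succ', mul_assoc, ← mul_assoc (PowerSeries.mk 1),
      PowerSeries.mk_one_mul_one_sub_eq_one, one_mul, ih]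

lemma exists_polynomial_mul_tauSeries {p : ℕ} (hp : p.Prime) (r a : ℕ) :
    ∃ P : Polynomial ℝ, tauSeries r p a = P * tauSeries r p 0 := by
  induction a with
  | zero => exact ⟨1, by simp⟩
  | succ a ih =>
    obtain ⟨P, hP⟩ := ih
    set c := (tauR r (p ^ a) : ℝ) with hc
    set Q : Polynomial ℝ := P - Polynomial.C c * (1 - Polynomial.X) ^ r with hQ
    have h0 : c = P.coeff 0 := by
      have := congrArg (PowerSeries.coeff 0) hP
      simpa [tauSeries, PowerSeries.coeff_mul, -PowerSeries.coeff_zero_eq_constantCoeff] using this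
    have hQ0 : Q.coeff 0 = 0 := by
      rw [hQ, Polynomial.coeff_sub, Polynomial.coeff_C_mul, ← h0]
      simp [Polynomial.coeff_zero_eq_eval_zero]
    have hX : Polynomial.X * Q.divX = Q := by
      have := Q.X_mul_divX_add
      rwa [hQ0, map_zero, add_zero] at this
    have hS : tauSeries r p a = PowerSeries.X * tauSeries r p (a + 1) + PowerSeries.C c := by
      ext k
      rcases k with _ | k
      · simp [tauSeries, hc]
      · simp [tauSeries, PowerSeries.coeff_succ_X_mul]
        ring_nf
    refine ⟨Q.divX, mul_left_cancel₀ PowerSeries.X_ne_zero ?_⟩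
    have hX' := congrArg (fun R : Polynomial ℝ => (R : PowerSeries ℝ)) hX
    simp only [hQ, Polynomial.coe_mul, Polynomial.coe_X, Polynomial.coe_sub, Polynomial.coe_pow,
      Polynomial.coe_C, Polynomial.coe_one] at hX'
    rw [← hQ] at hX'
    have h1 := tauSeries_zero_mul hp r
    linear_combination (-hS) + hP + PowerSeries.C c * h1 - tauSeries r p 0 * hX'

lemma summable_tauR_pow_prime {p : ℕ} (hp : p.Prime) (r : ℕ) :
    Summable fun k : ℕ => (tauR r (p ^ k) : ℝ) / p ^ k := by
  have hp1 : ‖(p : ℝ)⁻¹‖ < 1 := by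
    rw [norm_inv]
    exact inv_lt_one_of_one_lt₀ (by simpa using hp.one_lt)
  induction r with
  | zero =>
    refine summable_of_ne_finset_zero (s := {0}) fun k hk => ?_
    have : k ≠ 0 := by simpa using hk
    simp [tauR, hp.ne_one, this]
  | succ r ih =>
    refine (summable_norm_sum_mul_antidiagonal_of_summable_norm ih.norm
      (summable_geometric_of_norm_lt_one hp1).norm).of_norm.congr fun k => ?_
    rw [tauR_succ_pow_prime hp, Nat.cast_sum, Finset.sum_div]
    refine Finset.sum_congr rfl fun i hi => ?_
    rw [← mem_antidiagonal.1 hi, pow_add, inv_pow]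
    field_simp

lemma tauR_pos {r n : ℕ} (hr : 1 ≤ r) (hn : n ≠ 0) : 0 < tauR r n := by
  obtain ⟨r, rfl⟩ := Nat.exists_eq_add_of_le' hr
  clear hr
  rw [tauR, pow_succ, ArithmeticFunction.mul_zeta_apply]
  exact Finset.sum_pos' (by simp) ⟨1, by simp [hn],
    Nat.pos_of_ne_zero (by simp [(ArithmeticFunction.isMultiplicative_zeta.pow).map_one])⟩

lemma summable_tauR_pow_prime_shift {p : ℕ} (hp : p.Prime) (r a : ℕ) :
    Summable fun k : ℕ => (tauR r (p ^ (a + k)) : ℝ) / p ^ k := by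
  have h := ((summable_nat_add_iff a).2 (summable_tauR_pow_prime hp r)).mul_left ((p : ℝ) ^ a)
  have : (p : ℝ) ≠ 0 := by simpa using hp.ne_zero
  refine h.congr fun k => ?_
  rw [add_comm k a, pow_add (p : ℝ)]
  field_simp

lemma tsum_tauR_pow_prime_shift_pos {r p : ℕ} (hr : 1 ≤ r) (hp : p.Prime) (a : ℕ) :
    0 < ∑' k : ℕ, (tauR r (p ^ (a + k)) : ℝ) / p ^ k := by
  refine (summable_tauR_pow_prime_shift hp r a).tsum_pos (fun k => by positivity) 0 ?_
  have := tauR_pos hr (pow_ne_zero (a + 0) hp.ne_zero)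
  have := hp.pos
  positivity

lemma fOne_pos {r : ℕ} (hr : 1 ≤ r) (u : ℕ) : 0 < fOne r u := by
  refine Finset.prod_pos fun p hp => ?_
  have hp' := Nat.prime_of_mem_primeFactors hp
  have h := tsum_tauR_pow_prime_shift_pos hr hp' 0
  simp only [zero_add] at h
  exact div_pos (tsum_tauR_pow_prime_shift_pos hr hp' _) h

lemma tsum_tauR_shift_eq_eval_mul {p : ℕ} (hp : p.Prime) {r a : ℕ} {P : Polynomial ℝ}
    (hP : tauSeries r p a = P * tauSeries r p 0) :
    ∑' k : ℕ, (tauR r (p ^ (a + k)) : ℝ) / p ^ k =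
      P.eval (p : ℝ)⁻¹ * ∑' k : ℕ, (tauR r (p ^ k) : ℝ) / p ^ k := by
  have hz : ∀ k ∉ P.support, P.coeff k * ((p : ℝ)⁻¹) ^ k = 0 := fun k hk => by
    simp [Polynomial.notMem_support_iff.1 hk]
  have he : P.eval (p : ℝ)⁻¹ = ∑' k, P.coeff k * ((p : ℝ)⁻¹) ^ k := by
    rw [tsum_eq_sum hz, Polynomial.eval_eq_sum, Polynomial.sum]
  rw [he, tsum_mul_tsum_eq_tsum_sum_antidiagonal_of_summable_norm
    (summable_of_ne_finset_zero hz).norm (summable_tauR_pow_prime hp r).norm]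
  refine tsum_congr fun k => ?_
  have h := congrArg (PowerSeries.coeff k) hP
  simp only [tauSeries, PowerSeries.coeff_mk, PowerSeries.coeff_mul, Polynomial.coeff_coe,
    zero_add] at h
  rw [h, Finset.sum_div]
  refine Finset.sum_congr rfl fun i hi => ?_
  rw [← mem_antidiagonal.1 hi, pow_add, inv_pow]
  field_simp

lemma fOne_prime_pow_mul {r p a m : ℕ} (hp : p.Prime) (ha : 0 < a) (hm : m ≠ 0) (hpm : ¬ p ∣ m) :
    fOne r (p ^ a * m) = (∑' k : ℕ, (tauR r (p ^ (a + k)) : ℝ) / p ^ k) /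
      (∑' k : ℕ, (tauR r (p ^ k) : ℝ) / p ^ k) * fOne r m := by
  have hc : (p ^ a).Coprime m := Nat.Coprime.pow_left _ ((Nat.Prime.coprime_iff_not_dvd hp).2 hpm)
  have hpn : p ∉ m.primeFactors := fun h => hpm (Nat.dvd_of_mem_primeFactors h)
  have hf : (p ^ a * m).factorization = (p ^ a).factorization + m.factorization :=
    Nat.factorization_mul (pow_ne_zero _ hp.ne_zero) hm
  rw [fOne, hc.primeFactors_mul, Nat.primeFactors_prime_pow ha.ne' hp, ← Finset.insert_eq,
    Finset.prod_insert hpn, fOne]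
  congr 1
  · simp [hf, hp.factorization, Nat.factorization_eq_zero_of_not_dvd hpm]
  · refine Finset.prod_congr rfl fun q hq => ?_
    have hqp : p ≠ q := fun h => hpn (h ▸ hq)
    simp [hf, hp.factorization, hqp]

/-- `n ↦ τ_r(nu)` is the Dirichlet convolution of `τ_r` with a finitely supported function, whose
Dirichlet series takes the value `f₁(u)` at `1`. -/
lemma exists_tauR_mul_eq_sum {r : ℕ} (hr : 1 ≤ r) (u : ℕ) (hu : u ≠ 0) :
    ∃ (ι : Type) (_ : Fintype ι) (d : ι → ℕ) (c : ι → ℝ),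
      (∀ i, d i ≠ 0 ∧ (d i).primeFactors ⊆ u.primeFactors) ∧
      (∀ n, n ≠ 0 → (tauR r (n * u) : ℝ) =
        ∑ i, if d i ∣ n then c i * tauR r (n / d i) else 0) ∧
      fOne r u = ∑ i, c i / d i := by
  induction u using Nat.recOnPrimePow with
  | zero => simp at hu
  | one => exact ⟨Unit, inferInstance, fun _ => 1, fun _ => 1, by simp, by simp, by simp [fOne]⟩
  | prime_pow_mul m p a hp hpm ha ih =>
    have hm : m ≠ 0 := by rintro rfl; simp at hpm
    obtain ⟨ι, _, d, c, hd, hτ, hf⟩ := ih hm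
    obtain ⟨P, hP⟩ := exists_polynomial_mul_tauSeries hp r a
    have hpu : (p ^ a * m).primeFactors = insert p m.primeFactors := by
      rw [Nat.primeFactors_mul (pow_ne_zero _ hp.ne_zero) hm,
        Nat.primeFactors_prime_pow ha.ne' hp, ← Finset.insert_eq]
    have hpd : ∀ i, ¬ p ∣ d i := fun i h =>
      hpm (Nat.dvd_of_mem_primeFactors ((hd i).2 (Nat.mem_primeFactors.2 ⟨hp, h, (hd i).1⟩)))
    refine ⟨Fin (P.natDegree + 1) × ι, inferInstance, fun i => p ^ (i.1 : ℕ) * d i.2,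
      fun i => P.coeff i.1 * c i.2, fun i => ⟨?_, ?_⟩, fun n hn => ?_, ?_⟩
    · exact mul_ne_zero (pow_ne_zero _ hp.ne_zero) (hd i.2).1
    · rw [hpu, Nat.primeFactors_mul (pow_ne_zero _ hp.ne_zero) (hd i.2).1]
      refine Finset.union_subset ?_ ((hd i.2).2.trans (Finset.subset_insert _ _))
      intro q hq
      rw [Finset.mem_insert]
      exact .inl ((Nat.prime_dvd_prime_iff_eq (Nat.prime_of_mem_primeFactors hq) hp).1
        ((Nat.prime_of_mem_primeFactors hq).dvd_of_dvd_pow (Nat.dvd_of_mem_primeFactors hq)))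
    · obtain ⟨e, n', hpn, rfl⟩ := Nat.exists_eq_pow_mul_and_not_dvd hn p hp.ne_one
      have hn' : n' ≠ 0 := by rintro rfl; simp at hpn
      have hcop : ∀ k t, ¬ p ∣ t → (p ^ k).Coprime t := fun k t ht =>
        Nat.Coprime.pow_left _ ((Nat.Prime.coprime_iff_not_dvd hp).2 ht)
      have hsplit : p ^ e * n' * (p ^ a * m) = p ^ (a + e) * (n' * m) := by ring
      rw [hsplit, tauR_mul_of_coprime _ (hcop _ _ (hp.not_dvd_mul hpn hpm)), Nat.cast_mul,
        hτ n' hn', Fintype.sum_prod_type]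
      have h := congrArg (PowerSeries.coeff e) hP
      simp only [tauSeries, PowerSeries.coeff_mk, PowerSeries.coeff_mul, Polynomial.coeff_coe,
        zero_add, Nat.sum_antidiagonal_eq_sum_range_succ_mk] at h
      have h' : (tauR r (p ^ (a + e)) : ℝ) = ∑ j : Fin (P.natDegree + 1),
          if (j : ℕ) ≤ e then P.coeff j * tauR r (p ^ (e - j)) else 0 := by
        rw [h, Fin.sum_univ_eq_sum_range
          (fun j => if j ≤ e then P.coeff j * (tauR r (p ^ (e - j)) : ℝ) else 0),
          ← Finset.sum_filter]
        symm
        apply Finset.sum_subset_zero_on_sdiff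
        · intro j hj
          simp at hj ⊢
          omega
        · intro j hj
          simp at hj
          rw [Polynomial.coeff_eq_zero_of_natDegree_lt (by omega), zero_mul]
        · simp
      rw [h', Finset.sum_mul_sum]
      refine Finset.sum_congr rfl fun j _ => Finset.sum_congr rfl fun i _ => ?_
      have hdvd : p ^ (j : ℕ) * d i ∣ p ^ e * n' ↔ (j : ℕ) ≤ e ∧ d i ∣ n' := by
        constructor
        · intro h
          constructor
          · have := (hcop j n' hpn).dvd_of_dvd_mul_right ((Dvd.intro _ rfl).trans h)
            exact (Nat.pow_dvd_pow_iff_le_right hp.one_lt).1 this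
          · exact (hcop e (d i) (hpd i)).symm.dvd_of_dvd_mul_left ((Dvd.intro_left _ rfl).trans h)
        · rintro ⟨h1, h2⟩
          exact mul_dvd_mul (pow_dvd_pow _ h1) h2
      by_cases h1 : (j : ℕ) ≤ e
      · by_cases h2 : d i ∣ n'
        · rw [if_pos h1, if_pos h2, if_pos (hdvd.2 ⟨h1, h2⟩),
            Nat.mul_div_mul_comm (pow_dvd_pow _ h1) h2, Nat.pow_div h1 hp.pos,
            tauR_mul_of_coprime, Nat.cast_mul]
          · ring
          · exact hcop _ _ fun h => hpn (h.trans (Nat.div_dvd_of_dvd h2))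
        · simp [hdvd, h2]
      · simp [hdvd, h1]
    · have h0 := tsum_tauR_pow_prime_shift_pos hr hp 0
      simp only [zero_add] at h0
      rw [fOne_prime_pow_mul hp ha hm hpm, tsum_tauR_shift_eq_eval_mul hp hP,
        mul_div_cancel_right₀ _ h0.ne', hf, Fintype.sum_prod_type, Polynomial.eval_eq_sum_range,
        ← Fin.sum_univ_eq_sum_range (fun j => P.coeff j * ((p : ℝ)⁻¹) ^ j), Finset.sum_mul_sum]
      refine Finset.sum_congr rfl fun j _ => Finset.sum_congr rfl fun i _ => ?_
      push_cast
      rw [inv_pow]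
      field_simp

lemma sum_tauR_succ_div (r : ℕ) (x : ℝ) :
    ∑ n ∈ Ioc 0 ⌊x⌋₊, (tauR (r + 1) n : ℝ) / n =
      ∑ d ∈ Ioc 0 ⌊x⌋₊, (d : ℝ)⁻¹ * ∑ n ∈ Ioc 0 ⌊x / d⌋₊, (tauR r n : ℝ) / n := by
  let w : ArithmeticFunction ℝ := ⟨fun n => (n : ℝ)⁻¹, by simp⟩
  let g : ArithmeticFunction ℝ := ⟨fun n => (tauR r n : ℝ) / n, by simp⟩
  have h : ∀ n, (w * g) n = (tauR (r + 1) n : ℝ) / n := fun n => by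
    rw [tauR, pow_succ', ArithmeticFunction.mul_apply, ArithmeticFunction.mul_apply, Nat.cast_sum,
      Finset.sum_div]
    refine Finset.sum_congr rfl fun i hi => ?_
    obtain ⟨hi, hn⟩ := Nat.mem_divisorsAntidiagonal.1 hi
    have h1 : i.1 ≠ 0 := by rintro h; simp [h] at hi; exact hn hi.symm
    simp only [w, g, ArithmeticFunction.coe_mk, tauR, ← hi, ArithmeticFunction.zeta_apply, h1]
    push_cast
    simp
    field_simp
  have := ArithmeticFunction.sum_Ioc_mul_eq_sum_sum w g ⌊x⌋₊
  simp only [h] at this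
  simpa [w, g, Nat.floor_div_natCast] using this

lemma one_le_div_of_mem_Ioc {x : ℝ} {d : ℕ} (hd : d ∈ Ioc 0 ⌊x⌋₊) :
    0 < (d : ℝ) ∧ 1 ≤ x / d := by
  rw [mem_Ioc] at hd
  have h0 : 0 < (d : ℝ) := by exact_mod_cast hd.1
  exact ⟨h0, (one_le_div h0).2 ((Nat.le_floor_iff' hd.1.ne').1 hd.2)⟩

lemma sub_mul_pow_bounds (r : ℕ) {a b : ℝ} (hb : 0 ≤ b) (hab : b ≤ a) :
    (r + 1) * b ^ r * (a - b) ≤ a ^ (r + 1) - b ^ (r + 1) ∧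
      a ^ (r + 1) - b ^ (r + 1) ≤ (r + 1) * a ^ r * (a - b) := by
  induction r with
  | zero => simp
  | succ r ih =>
    have h0 : 0 ≤ a - b := sub_nonneg.2 hab
    have ha : 0 ≤ a := hb.trans hab
    have hp : b ^ (r + 1) ≤ a ^ (r + 1) := by gcongr
    have e : a ^ (r + 1 + 1) - b ^ (r + 1 + 1) =
      b * (a ^ (r + 1) - b ^ (r + 1)) + a ^ (r + 1) * (a - b) := by ring
    have e' : a ^ (r + 1 + 1) - b ^ (r + 1 + 1) =
      a * (a ^ (r + 1) - b ^ (r + 1)) + b ^ (r + 1) * (a - b) := by ring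
    have h1 := mul_le_mul_of_nonneg_left ih.1 hb
    have h2 := mul_le_mul_of_nonneg_left ih.2 ha
    have h3 := mul_le_mul_of_nonneg_right hp h0
    push_cast
    constructor
    · rw [e]; linear_combination h1 + h3
    · rw [e']; linear_combination h2 + h3

lemma log_pow_telescope_bounds (r : ℕ) {x : ℝ} {n : ℕ} (hn : 0 < n) (hx : (n + 1 : ℝ) ≤ x) :
    ((n + 1 : ℕ) : ℝ)⁻¹ * Real.log (x / (n + 1 : ℕ)) ^ r ≤
        (Real.log (x / n) ^ (r + 1) - Real.log (x / (n + 1 : ℕ)) ^ (r + 1)) / (r + 1) ∧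
      (Real.log (x / n) ^ (r + 1) - Real.log (x / (n + 1 : ℕ)) ^ (r + 1)) / (r + 1) ≤
        (n : ℝ)⁻¹ * Real.log (x / n) ^ r := by
  have hn0 : (0 : ℝ) < n := by exact_mod_cast hn
  push_cast
  have hx0 : 0 < x := by linarith
  have hb : 0 ≤ Real.log (x / (n + 1)) := Real.log_nonneg ((one_le_div (by positivity)).2 hx)
  have hd : Real.log (x / n) - Real.log (x / (n + 1)) = Real.log ((n + 1) / n) := by
    rw [Real.log_div hx0.ne' hn0.ne', Real.log_div hx0.ne' (by positivity),
      Real.log_div (by positivity) hn0.ne']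
    ring
  have hu : Real.log (((n : ℝ) + 1) / n) ≤ (n : ℝ)⁻¹ := by
    refine (Real.log_le_sub_one_of_pos (by positivity)).trans_eq ?_
    field_simp
    ring
  have hl : ((n : ℝ) + 1)⁻¹ ≤ Real.log (((n : ℝ) + 1) / n) := by
    refine le_trans (le_of_eq ?_) (Real.one_sub_inv_le_log_of_pos (by positivity))
    field_simp
    ring
  have hab : Real.log (x / (n + 1)) ≤ Real.log (x / n) := by
    have : 0 < ((n : ℝ) + 1)⁻¹ := by positivity
    linarith
  obtain ⟨h1, h2⟩ := sub_mul_pow_bounds r hb hab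
  rw [hd] at h1 h2
  have hA := hb.trans hab
  rw [le_div_iff₀ (by positivity), div_le_iff₀ (by positivity)]
  constructor
  · refine le_trans ?_ h1
    rw [mul_comm, ← mul_assoc, mul_right_comm]
    gcongr
  · refine h2.trans ?_
    rw [mul_comm ((n : ℝ)⁻¹ * _), ← mul_assoc, mul_right_comm]
    gcongr

lemma abs_sum_inv_mul_log_pow_sub_le (r : ℕ) {x : ℝ} (hx : 1 ≤ x) :
    |∑ n ∈ Ioc 0 ⌊x⌋₊, (n : ℝ)⁻¹ * Real.log (x / n) ^ r - Real.log x ^ (r + 1) / (r + 1)| ≤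
      (1 + Real.log x) ^ r := by
  set g : ℕ → ℝ := fun n => (n : ℝ)⁻¹ * Real.log (x / n) ^ r with hg
  set F : ℕ → ℝ := fun n => Real.log (x / n) ^ (r + 1) / (r + 1) with hF
  have key : ∀ N : ℕ, 1 ≤ N → (N : ℝ) ≤ x →
      F 1 - F N + g N ≤ ∑ n ∈ Ioc 0 N, g n ∧ ∑ n ∈ Ioc 0 N, g n ≤ g 1 + F 1 - F N := by
    intro N hN
    induction N, hN using Nat.le_induction with
    | base => intro; simp
    | succ n hn ih =>
      intro h
      push_cast at h
      obtain ⟨h1, h2⟩ := ih (by linarith)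
      obtain ⟨h3, h4⟩ := log_pow_telescope_bounds r hn h
      rw [sub_div] at h3 h4
      rw [Finset.sum_Ioc_succ_top (by omega)]
      constructor <;> simp only [hg, hF] at * <;> linarith
  have hN1 : 1 ≤ ⌊x⌋₊ := Nat.one_le_floor_iff x |>.2 hx
  have hNx : (⌊x⌋₊ : ℝ) ≤ x := Nat.floor_le (by linarith)
  have hN0 : (0 : ℝ) < ⌊x⌋₊ := by exact_mod_cast hN1
  obtain ⟨h1, h2⟩ := key ⌊x⌋₊ hN1 hNx
  have hL : 0 ≤ Real.log x := Real.log_nonneg hx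
  have hl0 : 0 ≤ Real.log (x / ⌊x⌋₊) := Real.log_nonneg ((one_le_div hN0).2 hNx)
  have hl1 : Real.log (x / ⌊x⌋₊) ≤ 1 := by
    refine (Real.log_le_sub_one_of_pos (by positivity)).trans ?_
    rw [sub_le_iff_le_add, div_le_iff₀ hN0]
    have : (1 : ℝ) ≤ ⌊x⌋₊ := by exact_mod_cast hN1
    linarith [Nat.lt_floor_add_one x]
  have hF0 : 0 ≤ F ⌊x⌋₊ := by positivity
  have hFle : F ⌊x⌋₊ ≤ 1 := by
    rw [hF, div_le_one (by positivity)]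
    exact (pow_le_one₀ hl0 hl1).trans (by linarith [(Nat.cast_nonneg r : (0 : ℝ) ≤ r)])
  have hg0 : 0 ≤ g ⌊x⌋₊ := by positivity
  have hF1 : F 1 = Real.log x ^ (r + 1) / (r + 1) := by simp [hF]
  have hg1 : g 1 = Real.log x ^ r := by simp [hg]
  have h5 : Real.log x ^ r ≤ (1 + Real.log x) ^ r := by gcongr; linarith
  have h6 : 1 ≤ (1 + Real.log x) ^ r := one_le_pow₀ (by linarith)
  rw [abs_le]
  constructor <;> linarith

lemma sum_inv_le {x : ℝ} (hx : 1 ≤ x) :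
    ∑ n ∈ Ioc 0 ⌊x⌋₊, (n : ℝ)⁻¹ ≤ 1 + Real.log x := by
  have h := (abs_le.1 (abs_sum_inv_mul_log_pow_sub_le 0 hx)).2
  simp at h
  linarith

lemma log_div_natCast_mem_Icc {x : ℝ} {d : ℕ} (hx : 1 ≤ x) (hd : d ∈ Ioc 0 ⌊x⌋₊) :
    0 ≤ Real.log (x / d) ∧ Real.log (x / d) ≤ Real.log x := by
  obtain ⟨h0, h1⟩ := one_le_div_of_mem_Ioc hd
  refine ⟨Real.log_nonneg h1, Real.log_le_log (by linarith) (div_le_self (by linarith) ?_)⟩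
  exact_mod_cast (mem_Ioc.1 hd).1

lemma sum_tauR_div_le (r : ℕ) {x : ℝ} (hx : 1 ≤ x) :
    ∑ n ∈ Ioc 0 ⌊x⌋₊, (tauR r n : ℝ) / n ≤ (1 + Real.log x) ^ r := by
  induction r generalizing x with
  | zero =>
    have : (1 : ℕ) ∈ Ioc 0 ⌊x⌋₊ := by simpa using hx
    rw [Finset.sum_eq_single_of_mem 1 this]
    · simp
    · intro n _ hn
      simp [tauR, hn]
  | succ r ih =>
    rw [sum_tauR_succ_div, pow_succ']
    have hL := Real.log_nonneg hx
    refine le_trans (Finset.sum_le_sum fun d hd => ?_) (?_ :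
      ∑ d ∈ Ioc 0 ⌊x⌋₊, (d : ℝ)⁻¹ * (1 + Real.log x) ^ r ≤ _)
    · obtain ⟨h0, h1⟩ := log_div_natCast_mem_Icc hx hd
      gcongr
      exact (ih (one_le_div_of_mem_Ioc hd).2).trans (by gcongr)
    · rw [← Finset.sum_mul]
      gcongr
      exact sum_inv_le hx

lemma exists_abs_sum_tauR_div_sub_le (r : ℕ) :
    ∃ C : ℝ, 0 ≤ C ∧ ∀ x : ℝ, 1 ≤ x →
      |∑ n ∈ Ioc 0 ⌊x⌋₊, (tauR (r + 1) n : ℝ) / n - Real.log x ^ (r + 1) / (r + 1).factorial| ≤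
        C * (1 + Real.log x) ^ r := by
  induction r with
  | zero =>
    refine ⟨1, zero_le_one, fun x hx => ?_⟩
    have h := abs_sum_inv_mul_log_pow_sub_le 0 hx
    have e : ∑ n ∈ Ioc 0 ⌊x⌋₊, (tauR (0 + 1) n : ℝ) / n = ∑ n ∈ Ioc 0 ⌊x⌋₊, (n : ℝ)⁻¹ := by
      refine Finset.sum_congr rfl fun n hn => ?_
      have : n ≠ 0 := (mem_Ioc.1 hn).1.ne'
      simp [tauR, this]
    rw [e]
    simpa using h
  | succ r ih =>
    obtain ⟨C, hC, h⟩ := ih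
    refine ⟨C + 1, by linarith, fun x hx => ?_⟩
    have hL := Real.log_nonneg hx
    set S := ∑ d ∈ Ioc 0 ⌊x⌋₊, (d : ℝ)⁻¹ * Real.log (x / d) ^ (r + 1) with hS
    have h1 : |∑ n ∈ Ioc 0 ⌊x⌋₊, (tauR (r + 1 + 1) n : ℝ) / n - S / (r + 1).factorial| ≤
        C * (1 + Real.log x) ^ (r + 1) := by
      rw [sum_tauR_succ_div, hS, Finset.sum_div, ← Finset.sum_sub_distrib]
      refine (Finset.abs_sum_le_sum_abs _ _).trans ?_
      refine le_trans (Finset.sum_le_sum fun d hd => ?_) (?_ :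
        ∑ d ∈ Ioc 0 ⌊x⌋₊, (d : ℝ)⁻¹ * (C * (1 + Real.log x) ^ r) ≤ _)
      · obtain ⟨h0, h1⟩ := log_div_natCast_mem_Icc hx hd
        rw [mul_div_assoc, ← mul_sub, abs_mul, abs_of_nonneg (by positivity)]
        gcongr
        exact (h _ (one_le_div_of_mem_Ioc hd).2).trans (by gcongr)
      · rw [← Finset.sum_mul, pow_succ', mul_left_comm]
        gcongr
        exact sum_inv_le hx
    have h2 := abs_sum_inv_mul_log_pow_sub_le (r + 1) hx
    have h3 : |S / (r + 1).factorial - Real.log x ^ (r + 1 + 1) / (r + 1 + 1).factorial| ≤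
        (1 + Real.log x) ^ (r + 1) := by
      have e : S / (r + 1).factorial - Real.log x ^ (r + 1 + 1) / (r + 1 + 1).factorial =
          (S - Real.log x ^ (r + 1 + 1) / ((r + 1 : ℕ) + 1)) / (r + 1).factorial := by
        rw [Nat.factorial_succ (r + 1)]
        push_cast
        field_simp
      rw [e, abs_div, abs_of_nonneg (a := ((r + 1).factorial : ℝ)) (by positivity)]
      refine (div_le_self (abs_nonneg _) ?_).trans h2
      exact_mod_cast (r + 1).factorial_pos
    refine (abs_sub_le _ _ _).trans ((add_le_add h1 h3).trans_eq ?_)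
    ring

lemma sum_tauR_succ (r N : ℕ) :
    ∑ n ∈ Ioc 0 N, (tauR (r + 1) n : ℝ) = ∑ n ∈ Ioc 0 N, (tauR r n : ℝ) * (N / n : ℕ) := by
  have := ArithmeticFunction.sum_Ioc_mul_zeta_eq_sum (ArithmeticFunction.zeta ^ r) N
  rw [ArithmeticFunction.natCoe_nat, ← pow_succ] at this
  exact_mod_cast this

lemma sum_tauR_succ_le (r : ℕ) {x : ℝ} (hx : 1 ≤ x) :
    ∑ n ∈ Ioc 0 ⌊x⌋₊, (tauR (r + 1) n : ℝ) ≤ x * (1 + Real.log x) ^ r := by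
  have h := mul_le_mul_of_nonneg_left (sum_tauR_div_le r hx) (zero_le_one.trans hx)
  refine le_trans ?_ h
  rw [sum_tauR_succ, Finset.mul_sum]
  refine Finset.sum_le_sum fun n hn => ?_
  rw [← Nat.floor_div_natCast, mul_div_left_comm]
  gcongr
  exact Nat.floor_le (by positivity)

lemma exists_abs_sum_tauR_sub_le (r : ℕ) :
    ∃ C : ℝ, 0 ≤ C ∧ ∀ x : ℝ, 1 ≤ x →
      |∑ n ∈ Ioc 0 ⌊x⌋₊, (tauR (r + 2) n : ℝ) -
        x * Real.log x ^ (r + 1) / (r + 1).factorial| ≤ C * (x * (1 + Real.log x) ^ r) := by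
  obtain ⟨C, hC, h⟩ := exists_abs_sum_tauR_div_sub_le r
  refine ⟨1 + C, by linarith, fun x hx => ?_⟩
  have hx0 : 0 ≤ x := by linarith
  have h1 : |∑ n ∈ Ioc 0 ⌊x⌋₊, (tauR (r + 2) n : ℝ) -
      x * ∑ n ∈ Ioc 0 ⌊x⌋₊, (tauR (r + 1) n : ℝ) / n| ≤ x * (1 + Real.log x) ^ r := by
    refine le_trans ?_ (sum_tauR_succ_le r hx)
    rw [sum_tauR_succ, Finset.mul_sum, ← Finset.sum_sub_distrib]
    refine (Finset.abs_sum_le_sum_abs _ _).trans (Finset.sum_le_sum fun n hn => ?_)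
    rw [← Nat.floor_div_natCast, mul_div_left_comm, ← mul_sub, abs_mul,
      abs_of_nonneg (Nat.cast_nonneg _)]
    refine mul_le_of_le_one_right (Nat.cast_nonneg _) ?_
    have h0 : 0 ≤ x / n := by positivity
    rw [abs_le]
    constructor <;> linarith [Nat.floor_le h0, Nat.lt_floor_add_one (x / n)]
  have h2 := mul_le_mul_of_nonneg_left (h x hx) hx0
  rw [← abs_of_nonneg hx0, ← abs_mul, abs_of_nonneg hx0, mul_sub] at h2
  refine (abs_sub_le _ _ _).trans ((add_le_add h1 (le_of_eq_of_le ?_ h2)).trans_eq ?_)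
  · rw [mul_div_assoc]
  · ring

lemma sum_tauR_isBigO (r : ℕ) :
    (fun x : ℝ => ∑ n ∈ Ioc 0 ⌊x⌋₊, (tauR (r + 1) n : ℝ) - x * Real.log x ^ r / r.factorial)
      =O[atTop] fun x : ℝ => x * Real.log x ^ r / Real.log x := by
  rcases r with _ | r
  · refine Asymptotics.IsBigO.of_bound 1 ?_
    filter_upwards [eventually_gt_atTop 1] with x hx
    have hL := Real.log_pos hx
    have hx0 : 0 ≤ x := by linarith
    have e : ∑ n ∈ Ioc 0 ⌊x⌋₊, (tauR (0 + 1) n : ℝ) = ⌊x⌋₊ := by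
      rw [Finset.sum_congr rfl (g := fun _ => (1 : ℝ)) fun n hn => ?_]
      · simp
      · simp [tauR, (mem_Ioc.1 hn).1.ne']
    have h1 : 1 ≤ x / Real.log x := by
      rw [one_le_div hL]
      linarith [Real.log_le_sub_one_of_pos (show 0 < x by linarith)]
    rw [e, Real.norm_eq_abs, Real.norm_eq_abs, pow_zero, mul_one, Nat.factorial_zero, Nat.cast_one,
      div_one, one_mul, abs_of_nonneg (a := x / Real.log x) (by positivity)]
    refine le_trans ?_ h1
    rw [abs_le]
    constructor <;> linarith [Nat.floor_le hx0, Nat.lt_floor_add_one x]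
  · obtain ⟨C, hC, h⟩ := exists_abs_sum_tauR_sub_le r
    refine Asymptotics.IsBigO.of_bound (C * 2 ^ r) ?_
    filter_upwards [eventually_gt_atTop 1, Real.tendsto_log_atTop.eventually_ge_atTop 1]
      with x hx hL
    have hx0 : 0 ≤ x := by linarith
    have hL0 : 0 ≤ Real.log x := by linarith
    rw [pow_succ (Real.log x), ← mul_assoc, mul_div_cancel_right₀ _ (by linarith : Real.log x ≠ 0),
      mul_assoc x, ← pow_succ, Real.norm_eq_abs, Real.norm_of_nonneg (by positivity)]
    refine (h x hx.le).trans ?_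
    rw [mul_assoc, mul_left_comm (2 ^ r), ← mul_pow]
    gcongr
    linarith

lemma log_sub_pow_sub_pow_isBigO (r : ℕ) (c : ℝ) :
    (fun x : ℝ => (Real.log x - c) ^ r - Real.log x ^ r)
      =O[atTop] fun x : ℝ => Real.log x ^ r / Real.log x := by
  have hc : (fun _ : ℝ => c) =O[atTop] Real.log :=
    (Real.isLittleO_const_log_atTop (c := c)).isBigO
  induction r with
  | zero => simpa using Asymptotics.isBigO_zero _ _
  | succ r ih =>
    have h1 := ((Asymptotics.isBigO_refl Real.log atTop).sub hc).mul ih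
    have h2 : (fun x : ℝ => c * Real.log x ^ r) =O[atTop] fun x => Real.log x ^ r :=
      Asymptotics.isBigO_const_mul_self _ _ _
    have e : (fun x : ℝ => Real.log x * (Real.log x ^ r / Real.log x)) =ᶠ[atTop]
        fun x => Real.log x ^ r := by
      filter_upwards [Real.tendsto_log_atTop.eventually_ne_atTop 0] with x hx
      field_simp
    have e' : (fun x : ℝ => Real.log x ^ (r + 1) / Real.log x) =ᶠ[atTop]
        fun x => Real.log x ^ r := by
      filter_upwards [Real.tendsto_log_atTop.eventually_ne_atTop 0] with x hx
      rw [pow_succ, mul_div_cancel_right₀ _ hx]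
    refine (((h1.trans_eventuallyEq e).sub h2).congr_left fun x => ?_).trans_eventuallyEq e'.symm
    ring

lemma log_div_natCast_pow_isBigO (r : ℕ) {d : ℕ} (hd : d ≠ 0) :
    (fun x : ℝ => Real.log (x / d) ^ r - Real.log x ^ r)
      =O[atTop] fun x : ℝ => Real.log x ^ r / Real.log x := by
  refine (log_sub_pow_sub_pow_isBigO r (Real.log d)).congr' ?_ .rfl
  filter_upwards [eventually_ne_atTop 0] with x hx
  rw [Real.log_div hx (by exact_mod_cast hd)]

lemma sum_tauR_div_natCast_isBigO (r : ℕ) {d : ℕ} (hd : d ≠ 0) :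
    (fun x : ℝ => ∑ n ∈ Ioc 0 ⌊x / d⌋₊, (tauR (r + 1) n : ℝ) -
        x / d * Real.log x ^ r / r.factorial)
      =O[atTop] fun x : ℝ => x * Real.log x ^ r / Real.log x := by
  have hd0 : (0 : ℝ) < d := by exact_mod_cast Nat.pos_of_ne_zero hd
  have ht : Tendsto (fun x : ℝ => x / d) atTop atTop := tendsto_id.atTop_div_const hd0
  have hE : (fun x : ℝ => x / d * Real.log (x / d) ^ r / Real.log (x / d))
      =O[atTop] fun x : ℝ => x * Real.log x ^ r / Real.log x := by
    refine Asymptotics.IsBigO.of_bound 2 ?_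
    filter_upwards [eventually_gt_atTop (d : ℝ), eventually_ge_atTop ((d : ℝ) ^ 2)] with x hx hx2
    have hx0 : 0 < x := hd0.trans hx
    have h1d : (1 : ℝ) ≤ d := by exact_mod_cast Nat.pos_of_ne_zero hd
    have hl : 0 < Real.log (x / d) := Real.log_pos ((one_lt_div hd0).2 hx)
    have hle : Real.log (x / d) ≤ Real.log x :=
      Real.log_le_log (by positivity) (div_le_self hx0.le h1d)
    have hle2 : Real.log x ≤ 2 * Real.log (x / d) := by
      have := Real.log_le_log (by positivity) hx2
      rw [Real.log_pow] at this
      rw [Real.log_div hx0.ne' hd0.ne']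
      push_cast at this
      linarith
    have hL : 0 < Real.log x := by linarith
    rw [Real.norm_of_nonneg (by positivity), Real.norm_of_nonneg (by positivity),
      mul_div_assoc' 2, div_le_div_iff₀ hl hL]
    calc x / d * Real.log (x / d) ^ r * Real.log x
        ≤ x * Real.log x ^ r * (2 * Real.log (x / d)) := by
          gcongr
          exact div_le_self hx0.le h1d
      _ = 2 * (x * Real.log x ^ r) * Real.log (x / d) := by ring
  have h1 := ((sum_tauR_isBigO r).comp_tendsto ht).trans hE
  have h2 := ((Asymptotics.isBigO_refl (fun x : ℝ => x) atTop).mul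
    (log_div_natCast_pow_isBigO r hd)).const_mul_left ((d : ℝ)⁻¹ * (r.factorial : ℝ)⁻¹)
  refine (h1.add (h2.congr_right fun x => (mul_div_assoc _ _ _).symm)).congr_left fun x => ?_
  simp only [Function.comp_apply]
  ring

lemma sum_ite_dvd_eq (f : ℕ → ℝ) {d : ℕ} (hd : d ≠ 0) (N : ℕ) :
    (∑ n ∈ Icc 1 N, if d ∣ n then f (n / d) else 0) = ∑ m ∈ Ioc 0 (N / d), f m := by
  have hd0 := Nat.pos_of_ne_zero hd
  rw [← Finset.sum_filter]
  refine Finset.sum_nbij' (· / d) (· * d) ?_ ?_ ?_ ?_ fun _ _ => rfl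
  · intro n hn
    simp only [mem_filter, mem_Icc, mem_Ioc] at hn ⊢
    exact ⟨Nat.div_pos (Nat.le_of_dvd (by omega) hn.2) hd0, Nat.div_le_div_right hn.1.2⟩
  · intro m hm
    simp only [mem_filter, mem_Icc, mem_Ioc] at hm ⊢
    exact ⟨⟨Nat.mul_pos hm.1 hd0, (Nat.le_div_iff_mul_le hd0).1 hm.2⟩, Dvd.intro_left m rfl⟩
  · intro n hn
    exact Nat.div_mul_cancel (mem_filter.1 hn).2
  · intro m _
    exact Nat.mul_div_cancel m hd0

/-- Fix `r, u ∈ ℕ`. Then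
`Σ_{n ≤ x} τ_r(nu) = (f₁(u) x (log x)^{r−1}/(r−1)!) (1 + O(1/log x))` as `x → ∞`. -/
theorem sum_tauR_dilated (r u : ℕ) (hr : 1 ≤ r) (hu : 1 ≤ u) :
    (fun x : ℝ =>
        (∑ n ∈ Finset.Icc 1 ⌊x⌋₊, (tauR r (n * u) : ℝ)) -
          fOne r u * x * Real.log x ^ (r - 1) / (r - 1).factorial)
      =O[atTop] fun x : ℝ =>
        fOne r u * x * Real.log x ^ (r - 1) / (r - 1).factorial / Real.log x := by
  obtain ⟨ι, _, d, c, hd, hτ, hf⟩ := exists_tauR_mul_eq_sum hr u (by omega)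
  have hf0 := fOne_pos hr u
  obtain ⟨r, rfl⟩ := Nat.exists_eq_add_of_le' hr
  rw [Nat.add_sub_cancel]
  have hR : (fun x : ℝ => x * Real.log x ^ r / Real.log x) =O[atTop] fun x : ℝ =>
      fOne (r + 1) u * x * Real.log x ^ r / r.factorial / Real.log x := by
    have hc : fOne (r + 1) u / r.factorial ≠ 0 := by positivity
    refine (Asymptotics.isBigO_self_const_mul hc _ _).congr_right fun x => ?_
    ring
  refine Asymptotics.IsBigO.trans ?_ hR
  refine (Asymptotics.IsBigO.fun_sum (s := Finset.univ) fun i _ =>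
    (sum_tauR_div_natCast_isBigO r (hd i).1).const_mul_left (c i)).congr_left fun x => ?_
  have hS : ∑ n ∈ Icc 1 ⌊x⌋₊, (tauR (r + 1) (n * u) : ℝ) =
      ∑ i, c i * ∑ n ∈ Ioc 0 ⌊x / d i⌋₊, (tauR (r + 1) n : ℝ) := by
    rw [Finset.sum_congr rfl fun n hn => hτ n (Nat.one_le_iff_ne_zero.1 (mem_Icc.1 hn).1),
      Finset.sum_comm]
    refine Finset.sum_congr rfl fun i _ => ?_
    rw [sum_ite_dvd_eq (fun m => c i * (tauR (r + 1) m : ℝ)) (hd i).1, Nat.floor_div_natCast,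
      Finset.mul_sum]
  rw [hS, hf]
  simp only [mul_sub, Finset.sum_sub_distrib, Finset.sum_mul, Finset.sum_div]
  congr 1
  exact Finset.sum_congr rfl fun i _ => by ring
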